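/- The raising operator R_d, applied to an admissible triangle in which row d is an X-row and row d−1 is a V-row of the same rank t, produces an admissible triangle in which the rank of row d−1 becomes t+1, and R_d preserves the weight of the triangle. -/

import Mathlib

open Finset
open scoped Classical

/-- Symbols occurring in a triangle: `x i`, `y i` (indices `1,...,n` encoded by `Fin n`),
`a i j`, `b i j` (the edge `{i+1,j+1}` oriented from smaller to larger, resp. larger to
smaller), and the numbers `1,...,n` of the bottom row. -/
inductive TSym (n : ℕ) where
  | x (i : Fin n)
  | y (i : Fin n)
  | a (i j : Fin n)
  | b (i j : Fin n)
  | num (i : Fin n)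
deriving DecidableEq

/-- A triangle of order `n`: row `r` (0-indexed) has `r+1` entries. -/
def Tri (n : ℕ) := ∀ r : Fin n, Fin (r.val + 1) → TSym n

namespace TSym

variable {n : ℕ}

/-- The symbol lies in `𝒳`. -/
def isX : TSym n → Prop
  | .x _ => True
  | .y _ => True
  | _ => False

/-- The symbol lies in `𝒱_k`. -/
def isV (k : ℕ) : TSym n → Prop
  | .a i j => j.val = i.val + k ∧ 0 < k
  | .b i j => j.val = i.val + k ∧ 0 < k
  | _ => False

/-- Well-formedness of a non-bottom entry: `a i j` and `b i j` require `i < j`;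
numbers may not occur. -/
def wf : TSym n → Prop
  | .a i j => i < j
  | .b i j => i < j
  | .num _ => False
  | _ => True

/-- The left value of a symbol lying in a row of rank `t` (values are `1`-based). -/
def lval (t : ℕ) : TSym n → ℤ
  | .x i => (i.val : ℤ) + 1
  | .y j => (j.val : ℤ) + 1 - t
  | .a i _ => (i.val : ℤ) + 1
  | .b i _ => (i.val : ℤ) + 1
  | .num i => (i.val : ℤ) + 1

/-- The right value of a symbol lying in a row of rank `t`. -/
def rval (t : ℕ) : TSym n → ℤ
  | .x i => (i.val : ℤ) + 1 + t
  | .y j => (j.val : ℤ) + 1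
  | .a _ j => (j.val : ℤ) + 1
  | .b _ j => (j.val : ℤ) + 1
  | .num i => (i.val : ℤ) + 1

end TSym

variable {n : ℕ}

/-- Row `r` is an `𝒳`-row. -/
def IsXRow (t : Tri n) (r : Fin n) : Prop := ∀ i, (t r i).isX

/-- Row `r` has all entries in `𝒱_k`. -/
def IsVRowOf (t : Tri n) (r : Fin n) (k : ℕ) : Prop := ∀ i, (t r i).isV k

/-- Row `r` is a `𝒱`-row. -/
def IsVRow (t : Tri n) (r : Fin n) : Prop := ∃ k, IsVRowOf t r k

/-- The bottom row is `(1,2,...,n)`. -/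
def BottomOK (t : Tri n) : Prop :=
  ∀ (r : Fin n), r.val = n - 1 → ∀ i : Fin (r.val + 1),
    t r i = .num ⟨i.val, by have := i.isLt; have := r.isLt; omega⟩

/-- All non-bottom entries are well-formed. -/
def WellFormed (t : Tri n) : Prop :=
  ∀ r : Fin n, r.val < n - 1 → ∀ i, (t r i).wf

/-- `rk m` is the rank of (1-based) row `m`, for `0 ≤ m ≤ n`; Lean row index `r`
corresponds to row `r+1`.  An admissible ranking: the bottom row has rank `0`,
row `n-1` has rank `1`, and going up, an `𝒳`-row keeps the rank while a row whose
entries lie in `𝒱_k` has rank `k` and raises the rank above it to `k+1`. -/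
def IsRanking (t : Tri n) (rk : ℕ → ℕ) : Prop :=
  rk n = 0 ∧ (1 ≤ n → rk (n - 1) = 1) ∧
  ∀ r : Fin n, r.val < n - 1 →
    (IsXRow t r ∧ rk r.val = rk (r.val + 1)) ∨
    (IsVRowOf t r (rk (r.val + 1)) ∧ rk r.val = rk (r.val + 1) + 1)

/-- The monotone diagonal and monotone row properties: for every local arrangement
`v` directly above consecutive entries `u, w`, we require `l(u) ≤ l(v)` (strict when
`u` is a `y`), `r(v) ≤ r(w)` (strict when `w` is an `x`), and `l(u) < l(w)`. -/
def MonoProps (t : Tri n) (rk : ℕ → ℕ) : Prop :=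
  ∀ (r : Fin n) (hr : 1 ≤ r.val) (p : ℕ) (hp : p + 1 < r.val + 1),
    let u := t r ⟨p, by omega⟩
    let w := t r ⟨p + 1, by omega⟩
    let v := t ⟨r.val - 1, by have := r.isLt; omega⟩ ⟨p, by simp only [Fin.val_mk]; omega⟩
    (u.lval (rk (r.val + 1)) ≤ v.lval (rk r.val)) ∧
    ((∃ j, u = .y j) → u.lval (rk (r.val + 1)) < v.lval (rk r.val)) ∧
    (v.rval (rk r.val) ≤ w.rval (rk (r.val + 1))) ∧
    ((∃ j, w = .x j) → v.rval (rk r.val) < w.rval (rk (r.val + 1))) ∧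
    (u.lval (rk (r.val + 1)) < w.lval (rk (r.val + 1)))

/-- Admissibility of a triangle. -/
def IsAdmissible (t : Tri n) : Prop :=
  BottomOK t ∧ WellFormed t ∧ ∃ rk, IsRanking t rk ∧ MonoProps t rk

/-- The rank of the row with Lean index `r` (i.e. of row `r+1`), computed directly:
one more than the number of `𝒱`-rows strictly below it (above the bottom row). -/
noncomputable def rankOf (t : Tri n) (r : ℕ) : ℕ :=
  1 + ((univ : Finset (Fin n)).filter fun s => r < s.val ∧ IsVRow t s).card

open MvPolynomial in
/-- The weight of a symbol. -/
noncomputable def TSym.weight : TSym n → MvPolynomial (Fin n ⊕ Fin n) ℤ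
  | .x i => X (Sum.inl i)
  | .y j => X (Sum.inr j)
  | .a i _ => X (Sum.inl i)
  | .b _ j => X (Sum.inr j)
  | .num _ => 1

/-- The weight of a triangle: the product of the weights of its non-bottom entries. -/
noncomputable def weight (t : Tri n) : MvPolynomial (Fin n ⊕ Fin n) ℤ :=
  ∏ r : Fin n, if r.val < n - 1 then ∏ i, (t r i).weight else 1

/-- The raising operator `R_d` (`1 ≤ d < n`), acting on (paper-indexed) rows `d-1`
and `d`, i.e. Lean rows `d-2` and `d-1`. -/
noncomputable def Raise (d : ℕ) (t : Tri n) : Tri n := fun r i =>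
  if hu : 2 ≤ d ∧ r.val + 2 = d ∧ r.val + 1 < n then
    -- row d-1: swap with the entry diagonally below, else convert to an 𝒳-symbol
    match t r i with
    | .b j k =>
        if t ⟨r.val + 1, hu.2.2⟩ ⟨i.val, by have := i.isLt; simp only [Fin.val_mk]; omega⟩
            = .x j then .x j else .y k
    | .a j k =>
        if t ⟨r.val + 1, hu.2.2⟩ ⟨i.val + 1, by have := i.isLt; simp only [Fin.val_mk]; omega⟩
            = .y k then .y k else .x j
    | s => s
  else if hl : r.val + 1 = d then
    -- row d: swap with the entry diagonally above, else convert to a 𝒱-symbol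
    let tk := rankOf t r.val
    match t r i with
    | .x j =>
        if hi : i.val < r.val then
          match t ⟨r.val - 1, by have := r.isLt; omega⟩
              ⟨i.val, by simp only [Fin.val_mk]; omega⟩ with
          | .b j' k => if j' = j then .b j' k
              else if h2 : j.val + tk < n then .a j ⟨j.val + tk, h2⟩ else .x j
          | _ => if h2 : j.val + tk < n then .a j ⟨j.val + tk, h2⟩ else .x j
        else if h2 : j.val + tk < n then .a j ⟨j.val + tk, h2⟩ else .x j
    | .y k =>
        if hi : 1 ≤ i.val then
          match t ⟨r.val - 1, by have := r.isLt; omega⟩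
              ⟨i.val - 1, by have := i.isLt; simp only [Fin.val_mk]; omega⟩ with
          | .a j k' => if k' = k then .a j k'
              else if h2 : tk ≤ k.val then .b ⟨k.val - tk, by have := k.isLt; omega⟩ k
              else .y k
          | _ => if h2 : tk ≤ k.val then .b ⟨k.val - tk, by have := k.isLt; omega⟩ k
              else .y k
        else if h2 : tk ≤ k.val then .b ⟨k.val - tk, by have := k.isLt; omega⟩ k else .y k
    | s => s
  else t r i

/-- The lowering operator `L_d` (`1 ≤ d < n`), inverse to `R_d`. -/
noncomputable def Lower (d : ℕ) (t : Tri n) : Tri n := fun r i =>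
  if hu : 2 ≤ d ∧ r.val + 2 = d ∧ r.val + 1 < n then
    -- row d-1: swap with the entry diagonally below, else convert to a 𝒱-symbol
    let tk := rankOf t (r.val + 1)
    match t r i with
    | .x j =>
        (match t ⟨r.val + 1, hu.2.2⟩ ⟨i.val, by have := i.isLt; simp only [Fin.val_mk]; omega⟩ with
          | .b j' k => if j' = j then .b j' k
              else if h2 : j.val + tk < n then .a j ⟨j.val + tk, h2⟩ else .x j
          | _ => if h2 : j.val + tk < n then .a j ⟨j.val + tk, h2⟩ else .x j)
    | .y k =>
        (match t ⟨r.val + 1, hu.2.2⟩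
            ⟨i.val + 1, by have := i.isLt; simp only [Fin.val_mk]; omega⟩ with
          | .a j k' => if k' = k then .a j k'
              else if h2 : tk ≤ k.val then .b ⟨k.val - tk, by have := k.isLt; omega⟩ k
              else .y k
          | _ => if h2 : tk ≤ k.val then .b ⟨k.val - tk, by have := k.isLt; omega⟩ k
              else .y k)
    | s => s
  else if hl : r.val + 1 = d then
    -- row d: swap with the entry diagonally above, else convert to an 𝒳-symbol
    match t r i with
    | .b j k =>
        if hi : i.val < r.val then
          (if t ⟨r.val - 1, by have := r.isLt; omega⟩
              ⟨i.val, by simp only [Fin.val_mk]; omega⟩ = .x j then .x j else .y k)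
        else .y k
    | .a j k =>
        if hi : 1 ≤ i.val then
          (if t ⟨r.val - 1, by have := r.isLt; omega⟩
              ⟨i.val - 1, by have := i.isLt; simp only [Fin.val_mk]; omega⟩ = .y k
           then .y k else .x j)
        else .x j
    | s => s
  else t r i

namespace TSym

/-- The image of an upper entry `v` under raising, given the entries `e` (below-left) and
`e2` (below-right). -/
noncomputable def raiseUpper (e e2 v : TSym n) : TSym n :=
  match v with
  | .b j k => if e = .x j then .x j else .y k
  | .a j k => if e2 = .y k then .y k else .x j
  | s => s

/-- The `𝒱_k`-symbol obtained from an `𝒳`-symbol without swapping. -/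
noncomputable def toV (k : ℕ) : TSym n → TSym n
  | .x j => if h : j.val + k < n then .a j ⟨j.val + k, h⟩ else .x j
  | .y j => if k ≤ j.val then .b ⟨j.val - k, by have := j.isLt; omega⟩ j else .y j
  | s => s

/-- The image of a lower entry `e` under raising, given the entries `vl` (above-left) and
`vr` (above-right), where a missing neighbour is represented by a number. -/
noncomputable def raiseLower (k : ℕ) (vl vr e : TSym n) : TSym n :=
  match e with
  | .x j =>
    match vr with
    | .b j' k' => if j' = j then .b j' k' else toV k (.x j)
    | _ => toV k (.x j)
  | .y j =>
    match vl with
    | .a j' k' => if k' = j then .a j' k' else toV k (.y j)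
    | _ => toV k (.y j)
  | s => s

/-- The local monotonicity condition for `v` above `u, w`, in rows of rank `s` and `k`. -/
def LocalMono (k s : ℕ) (u w v : TSym n) : Prop :=
  (u.lval k ≤ v.lval s) ∧ ((∃ j, u = .y j) → u.lval k < v.lval s) ∧
  (v.rval s ≤ w.rval k) ∧ ((∃ j, w = .x j) → v.rval s < w.rval k) ∧
  (u.lval k < w.lval k)

lemma isX.rval_eq {e : TSym n} (h : e.isX) (k : ℕ) : e.rval k = e.lval k + k := by
  cases e <;> simp_all [isX, rval, lval]

lemma isV.rval_eq {e : TSym n} {k : ℕ} (h : e.isV k) (s : ℕ) :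
    e.rval s = e.lval s + k := by
  cases e <;> simp_all [isV, rval, lval] <;> omega

lemma isV.lval_eq {e : TSym n} {k : ℕ} (h : e.isV k) (s s' : ℕ) :
    e.lval s = e.lval s' := by
  cases e <;> simp_all [isV, lval]

lemma isV.ne_x {e : TSym n} {k : ℕ} (h : e.isV k) (j : Fin n) : e ≠ .x j := by
  rintro rfl; exact h

lemma isV.ne_y {e : TSym n} {k : ℕ} (h : e.isV k) (j : Fin n) : e ≠ .y j := by
  rintro rfl; exact h

lemma isV.not_isX {e : TSym n} {k : ℕ} (h : e.isV k) : ¬ e.isX := by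
  cases e <;> simp_all [isV, isX]

lemma isV.wf {e : TSym n} {k : ℕ} (h : e.isV k) : e.wf := by
  cases e <;> simp_all [isV, TSym.wf, Fin.lt_def]

lemma isX.wf {e : TSym n} (h : e.isX) : e.wf := by
  cases e <;> simp_all [isX, TSym.wf]

lemma toV_spec {e : TSym n} {k : ℕ} (hk : 0 < k) (he : e.isX)
    (hl : 1 ≤ e.lval k) (hr : e.rval k ≤ n) :
    (toV k e).isV k ∧ (toV k e).lval k = e.lval k := by
  cases e with
  | x j =>
    have h : j.val + k < n := by simp only [rval] at hr; omega
    simp [toV, h, isV, lval, hk]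
  | y j =>
    have h : k ≤ j.val := by simp only [lval] at hl; omega
    simp only [toV, h, if_true, isV, lval]
    omega
  | _ => exact he.elim

lemma raiseLower_spec {e vl vr : TSym n} {k : ℕ} (hk : 0 < k) (he : e.isX)
    (hl : 1 ≤ e.lval k) (hr : e.rval k ≤ n)
    (hvl : vl.isV k ∨ ∃ j, vl = .num j) (hvr : vr.isV k ∨ ∃ j, vr = .num j) :
    (raiseLower k vl vr e).isV k ∧ (raiseLower k vl vr e).lval k = e.lval k := by
  have h := toV_spec hk he hl hr
  cases e with
  | x j =>
    cases vr with
    | b j' k' =>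
      by_cases hj : j' = j
      · subst hj
        simpa [raiseLower, isV, lval] using hvr
      · simpa [raiseLower, hj] using h
    | _ => simpa [raiseLower] using h
  | y j =>
    cases vl with
    | a j' k' =>
      by_cases hj : k' = j
      · subst hj
        simp only [raiseLower, isV, lval, if_true]
        simp only [isV, reduceCtorEq, exists_false, or_false] at hvl
        omega
      · simpa [raiseLower, hj] using h
    | _ => simpa [raiseLower] using h
  | _ => exact he.elim

lemma raiseUpper_isX {e e2 v : TSym n} {k : ℕ} (hv : v.isV k) : (raiseUpper e e2 v).isX := by
  cases v <;> simp only [raiseUpper] <;> try exact hv.elim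
  all_goals split_ifs <;> trivial

lemma raiseUpper_lval {e e2 v : TSym n} {k : ℕ} (hv : v.isV k) :
    ((∃ j, raiseUpper e e2 v = .x j) ∧ (raiseUpper e e2 v).lval (k + 1) = v.lval k) ∨
    ((∃ j, raiseUpper e e2 v = .y j) ∧ (raiseUpper e e2 v).lval (k + 1) = v.lval k - 1) := by
  cases v <;> simp only [raiseUpper] <;> try exact hv.elim
  all_goals
    simp only [isV] at hv
    split_ifs <;> simp [lval] <;> omega

lemma raiseUpper_between {e e2 v : TSym n} {k : ℕ} (he : e.isX) (he2 : e2.isX)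
    (hv : v.isV k) (h : LocalMono k k e e2 v) :
    e.lval k ≤ (raiseUpper e e2 v).lval (k + 1) ∧
      (raiseUpper e e2 v).lval (k + 1) < e2.lval k := by
  obtain ⟨h1, h2, h3, h4, h5⟩ := h
  rw [hv.rval_eq, he2.rval_eq] at h3 h4
  cases v with
  | a j l =>
    simp only [isV] at hv
    simp only [raiseUpper]
    cases e2 <;> try exact he2.elim
    all_goals
      simp [lval, Fin.ext_iff] at *
      try split_ifs
      all_goals try simp at *
      all_goals omega
  | b j l =>
    simp only [isV] at hv
    simp only [raiseUpper]
    cases e <;> try exact he.elim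
    all_goals
      simp [lval, Fin.ext_iff] at *
      try split_ifs
      all_goals try simp at *
      all_goals omega
  | _ => exact hv.elim

open MvPolynomial

/-- Weight lost by the lower entry `e` in a swap with the upper entry `v` above-right of it. -/
noncomputable def swapRightOld : TSym n → TSym n → MvPolynomial (Fin n ⊕ Fin n) ℤ
  | .x j, .b j' _ => if j' = j then X (Sum.inl j) else 1
  | _, _ => 1

/-- Weight gained by the lower entry `e` in a swap with the upper entry `v` above-right of it. -/
noncomputable def swapRightNew : TSym n → TSym n → MvPolynomial (Fin n ⊕ Fin n) ℤ
  | .x j, .b j' k => if j' = j then X (Sum.inr k) else 1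
  | _, _ => 1

/-- Weight lost by the lower entry `e` in a swap with the upper entry `v` above-left of it. -/
noncomputable def swapLeftOld : TSym n → TSym n → MvPolynomial (Fin n ⊕ Fin n) ℤ
  | .y k, .a _ k' => if k' = k then X (Sum.inr k) else 1
  | _, _ => 1

/-- Weight gained by the lower entry `e` in a swap with the upper entry `v` above-left of it. -/
noncomputable def swapLeftNew : TSym n → TSym n → MvPolynomial (Fin n ⊕ Fin n) ℤ
  | .y k, .a j k' => if k' = k then X (Sum.inl j) else 1
  | _, _ => 1

lemma swapRightOld_ne_zero (e v : TSym n) : swapRightOld e v ≠ 0 := by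
  unfold swapRightOld; split <;> (try split_ifs) <;> simp

lemma swapRightNew_ne_zero (e v : TSym n) : swapRightNew e v ≠ 0 := by
  unfold swapRightNew; split <;> (try split_ifs) <;> simp

lemma swapLeftOld_ne_zero (e v : TSym n) : swapLeftOld e v ≠ 0 := by
  unfold swapLeftOld; split <;> (try split_ifs) <;> simp

lemma swapLeftNew_ne_zero (e v : TSym n) : swapLeftNew e v ≠ 0 := by
  unfold swapLeftNew; split <;> (try split_ifs) <;> simp

lemma swapRightOld_num (e : TSym n) (j : Fin n) : swapRightOld e (.num j) = 1 := by
  cases e <;> rfl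

lemma swapRightNew_num (e : TSym n) (j : Fin n) : swapRightNew e (.num j) = 1 := by
  cases e <;> rfl

lemma swapLeftOld_num (e : TSym n) (j : Fin n) : swapLeftOld e (.num j) = 1 := by
  cases e <;> rfl

lemma swapLeftNew_num (e : TSym n) (j : Fin n) : swapLeftNew e (.num j) = 1 := by
  cases e <;> rfl

lemma toV_weight (k : ℕ) (e : TSym n) : (toV k e).weight = e.weight := by
  cases e <;> simp only [toV] <;> (try split_ifs) <;> rfl

lemma raiseLower_weight (k : ℕ) (vl vr e : TSym n) :
    (raiseLower k vl vr e).weight * (swapRightOld e vr * swapLeftOld e vl) =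
      e.weight * (swapRightNew e vr * swapLeftNew e vl) := by
  cases e with
  | x j =>
    cases vr <;>
      simp only [raiseLower, swapRightOld, swapRightNew, swapLeftOld, swapLeftNew, toV_weight]
    split_ifs with h
    · subst h; simp only [weight]; ring
    · simp only [toV_weight]
  | y j =>
    cases vl <;>
      simp only [raiseLower, swapRightOld, swapRightNew, swapLeftOld, swapLeftNew, toV_weight]
    split_ifs with h
    · subst h; simp only [weight]; ring
    · simp only [toV_weight]
  | _ => rfl

lemma raiseUpper_weight (e e2 v : TSym n) :
    (raiseUpper e e2 v).weight * (swapRightNew e v * swapLeftNew e2 v) =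
      v.weight * (swapRightOld e v * swapLeftOld e2 v) := by
  cases v with
  | a j k =>
    cases e <;> cases e2 <;>
      simp only [raiseUpper, swapRightOld, swapRightNew, swapLeftOld, swapLeftNew, reduceCtorEq,
        if_false, weight]
    all_goals
      simp only [y.injEq]
      split_ifs <;> simp_all <;> ring
  | b j k =>
    cases e <;> cases e2 <;>
      simp only [raiseUpper, swapRightOld, swapRightNew, swapLeftOld, swapLeftNew, reduceCtorEq,
        if_false, weight]
    all_goals
      simp only [x.injEq]
      split_ifs <;> simp_all <;> ring
  | _ => cases e <;> cases e2 <;> rfl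

end TSym

section Entries

open TSym

variable [NeZero n]

/-- The entry at position `i` of row `r` (both `0`-indexed), as a total function. -/
noncomputable def ent (t : Tri n) (r i : ℕ) : TSym n :=
  if h : r < n ∧ i < r + 1 then t ⟨r, h.1⟩ ⟨i, h.2⟩ else .num 0

lemma ent_eq (t : Tri n) {r i : ℕ} (hr : r < n) (hi : i < r + 1) :
    ent t r i = t ⟨r, hr⟩ ⟨i, hi⟩ := dif_pos ⟨hr, hi⟩

lemma ent_raise_upper (t : Tri n) {r i : ℕ} (hr : r + 1 < n) (hi : i < r + 1) :
    ent (Raise (r + 2) t) r i =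
      raiseUpper (ent t (r + 1) i) (ent t (r + 1) (i + 1)) (ent t r i) := by
  rw [ent_eq _ (by omega) hi, ent_eq _ (by omega) hi, ent_eq _ hr (by omega),
    ent_eq _ hr (by omega)]
  simp only [Raise]
  rw [dif_pos ⟨by omega, trivial, hr⟩]
  unfold raiseUpper
  cases t ⟨r, by omega⟩ ⟨i, hi⟩ <;> rfl

/-- The entry above-left of position `(r, i)`, or a number when there is none. -/
noncomputable def aboveLeft (t : Tri n) (r i : ℕ) : TSym n :=
  if 1 ≤ i then ent t (r - 1) (i - 1) else .num 0

/-- The entry above-right of position `(r, i)`, or a number when there is none. -/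
noncomputable def aboveRight (t : Tri n) (r i : ℕ) : TSym n :=
  if i < r then ent t (r - 1) i else .num 0

lemma ent_raise_lower (t : Tri n) {r i : ℕ} (hr : r < n) (hi : i < r + 1) :
    ent (Raise (r + 1) t) r i =
      raiseLower (rankOf t r) (aboveLeft t r i) (aboveRight t r i) (ent t r i) := by
  rw [ent_eq _ hr hi, ent_eq _ hr hi]
  simp only [Raise]
  rw [dif_neg (by omega)]
  simp only [dite_true]
  unfold raiseLower
  cases t ⟨r, hr⟩ ⟨i, hi⟩ with
  | x j =>
    by_cases h : i < r
    · simp only [h, dite_true, aboveRight, if_true]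
      rw [ent_eq t (by omega) (by omega)]
      cases t ⟨r - 1, by omega⟩ ⟨i, by simp only; omega⟩ <;> rfl
    · simp only [h, dite_false, aboveRight, if_false]
      rfl
  | y j =>
    by_cases h : 1 ≤ i
    · simp only [h, dite_true, aboveLeft, if_true]
      rw [ent_eq t (by omega) (by omega)]
      cases t ⟨r - 1, by omega⟩ ⟨i - 1, by simp only; omega⟩ <;> rfl
    · simp only [h, dite_false, aboveLeft, if_false]
      rfl
  | _ => rfl

omit [NeZero n] in
lemma raise_row_of_ne {d : ℕ} (t : Tri n) (r : Fin n) (h1 : r.val + 1 ≠ d)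
    (h2 : r.val + 2 ≠ d) : Raise d t r = t r := by
  funext i
  simp only [Raise]
  rw [dif_neg (by tauto), dif_neg h1]

lemma ent_raise_of_ne {d : ℕ} (t : Tri n) {r i : ℕ} (h1 : r + 1 ≠ d) (h2 : r + 2 ≠ d) :
    ent (Raise d t) r i = ent t r i := by
  unfold ent
  split_ifs with h
  · rw [raise_row_of_ne t ⟨r, h.1⟩ h1 h2]
  · rfl

lemma isXRow_iff (t : Tri n) {r : ℕ} (hr : r < n) :
    IsXRow t ⟨r, hr⟩ ↔ ∀ i < r + 1, (ent t r i).isX :=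
  ⟨fun h i hi => ent_eq t hr hi ▸ h ⟨i, hi⟩, fun h i => ent_eq t hr i.2 ▸ h i i.2⟩

lemma isVRowOf_iff (t : Tri n) {r : ℕ} (hr : r < n) (k : ℕ) :
    IsVRowOf t ⟨r, hr⟩ k ↔ ∀ i < r + 1, (ent t r i).isV k :=
  ⟨fun h i hi => ent_eq t hr hi ▸ h ⟨i, hi⟩, fun h i => ent_eq t hr i.2 ▸ h i i.2⟩

lemma monoProps_iff (t : Tri n) (rk : ℕ → ℕ) :
    MonoProps t rk ↔ ∀ r p, r + 1 < n → p < r + 1 →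
      LocalMono (rk (r + 2)) (rk (r + 1)) (ent t (r + 1) p) (ent t (r + 1) (p + 1))
        (ent t r p) := by
  constructor
  · intro h r p hr hp
    rw [ent_eq t hr (by omega), ent_eq t hr (by omega), ent_eq t (by omega) hp]
    exact h ⟨r + 1, hr⟩ (by simp) p (by simpa using hp)
  · rintro h ⟨r, hr⟩ hr1 p hp
    obtain _ | r := r
    · simp at hr1
    · have h' := h r p hr (by simpa using hp)
      rw [ent_eq t hr (by simp at hp; omega), ent_eq t hr hp,
        ent_eq t (by omega) (by simpa using hp)] at h'
      exact h'

omit [NeZero n] in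
lemma IsXRow.not_isVRow {t : Tri n} {r : Fin n} (hX : IsXRow t r) : ¬ IsVRow t r :=
  fun ⟨_, hk⟩ => (hk 0).not_isX (hX 0)

omit [NeZero n] in
lemma BottomOK.not_isVRow {t : Tri n} (hb : BottomOK t) {r : Fin n} (hr : r.val = n - 1) :
    ¬ IsVRow t r := by
  rintro ⟨k, hk⟩
  have := hk 0
  rw [hb r hr] at this
  exact this

omit [NeZero n] in
lemma rankOf_eq_of_isVRow {t : Tri n} {r : ℕ} (hr : r + 1 < n) (h : IsVRow t ⟨r + 1, hr⟩) :
    rankOf t r = rankOf t (r + 1) + 1 := by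
  unfold rankOf
  have : (univ.filter fun s : Fin n => r < s.val ∧ IsVRow t s) =
      insert ⟨r + 1, hr⟩ (univ.filter fun s : Fin n => r + 1 < s.val ∧ IsVRow t s) := by
    ext s
    simp only [mem_filter, mem_univ, true_and, mem_insert]
    constructor
    · rintro ⟨h1, h2⟩
      by_cases h3 : s.val = r + 1
      · exact Or.inl (Fin.ext h3)
      · exact Or.inr ⟨by omega, h2⟩
    · rintro (rfl | h)
      · exact ⟨by simp, h⟩
      · exact ⟨by omega, h.2⟩
  rw [this, card_insert_of_notMem (by simp)]
  omega

omit [NeZero n] in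
lemma rankOf_eq_of_not_isVRow {t : Tri n} {r : ℕ} (hr : r + 1 < n)
    (h : ¬ IsVRow t ⟨r + 1, hr⟩) : rankOf t r = rankOf t (r + 1) := by
  unfold rankOf
  congr 2
  ext s
  simp only [mem_filter, mem_univ, true_and]
  constructor
  · rintro ⟨h1, h2⟩
    by_cases h3 : s.val = r + 1
    · exact absurd ((Fin.ext h3 : s = ⟨r + 1, hr⟩) ▸ h2) h
    · exact ⟨by omega, h2⟩
  · exact fun h => ⟨by omega, h.2⟩

omit [NeZero n] in
lemma rankOf_last {t : Tri n} {r : ℕ} (hr : r + 1 = n) : rankOf t r = 1 := by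
  unfold rankOf
  rw [filter_false_of_mem]
  · rfl
  · rintro s -
    have := s.2
    omega

omit [NeZero n] in
/-- The explicitly computed rank agrees with any admissible ranking. -/
lemma rankOf_eq {t : Tri n} {rk : ℕ → ℕ} (hb : BottomOK t) (hrk : IsRanking t rk)
    {r : ℕ} (hr : r + 1 < n) : rankOf t r = rk (r + 1) := by
  obtain ⟨c, hc⟩ : ∃ c, r + 2 + c = n := ⟨n - (r + 2), by omega⟩
  induction c generalizing r with
  | zero =>
    rw [rankOf_eq_of_not_isVRow hr (hb.not_isVRow (by simp; omega)), rankOf_last (by omega),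
      show r + 1 = n - 1 by omega, hrk.2.1 (by omega)]
  | succ c ih =>
    rcases hrk.2.2 ⟨r + 1, hr⟩ (by simp; omega) with ⟨hX, h⟩ | ⟨hV, h⟩
    · rw [rankOf_eq_of_not_isVRow hr (IsXRow.not_isVRow hX), ih (by omega) (by omega)]
      exact h.symm
    · rw [rankOf_eq_of_isVRow hr ⟨_, hV⟩, ih (by omega) (by omega)]
      exact h.symm

omit [NeZero n] in
lemma IsRanking.pos {t : Tri n} {rk : ℕ → ℕ} (hb : BottomOK t) (hrk : IsRanking t rk)
    {r : ℕ} (hr : r + 1 < n) : 0 < rk (r + 1) := by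
  rw [← rankOf_eq hb hrk hr]
  unfold rankOf
  omega

/-- All left values are at least `1` and all right values are at most `n`. -/
lemma ent_bounds {t : Tri n} {rk : ℕ → ℕ} (hb : BottomOK t)
    (hm : MonoProps t rk) {r i : ℕ} (hr : r < n) (hi : i < r + 1) :
    1 ≤ (ent t r i).lval (rk (r + 1)) ∧ (ent t r i).rval (rk (r + 1)) ≤ n := by
  rw [monoProps_iff] at hm
  obtain ⟨c, hc⟩ : ∃ c, r + 1 + c = n := ⟨n - (r + 1), by omega⟩
  induction c generalizing r i with
  | zero =>
    rw [ent_eq t hr hi, hb ⟨r, hr⟩ (by simp; omega)]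
    simp only [lval, rval]
    omega
  | succ c ih =>
    obtain ⟨h1, -, h3, -, -⟩ := hm r i (by omega) hi
    have hl := (ih (r := r + 1) (i := i) (by omega) (by omega) (by omega)).1
    have hr := (ih (r := r + 1) (i := i + 1) (by omega) (by omega) (by omega)).2
    exact ⟨hl.trans h1, h3.trans hr⟩

omit [NeZero n] in
lemma IsRanking.wellFormed {t : Tri n} {rk : ℕ → ℕ} (hrk : IsRanking t rk) :
    WellFormed t := by
  intro r hr i
  rcases hrk.2.2 r hr with ⟨h, -⟩ | ⟨h, -⟩
  · exact (h i).wf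
  · exact (h i).wf

lemma weight_eq (t : Tri n) :
    weight t = ∏ r ∈ range (n - 1), ∏ i ∈ range (r + 1), (ent t r i).weight := by
  have h : ∀ r : Fin n, (∏ i, (t r i).weight) =
      ∏ i ∈ range (r.val + 1), (ent t r i).weight := by
    intro r
    rw [← Fin.prod_univ_eq_prod_range (fun i => (ent t r i).weight)]
    exact prod_congr rfl fun i _ => by rw [ent_eq t r.2 i.2]
  unfold _root_.weight
  simp only [h]
  rw [Fin.prod_univ_eq_prod_range
    (fun r => if r < n - 1 then ∏ i ∈ range (r + 1), (ent t r i).weight else 1) n,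
    ← prod_filter]
  congr 1
  ext r
  simp only [mem_filter, mem_range]
  omega

lemma raise_weight_rows (t : Tri n) {q : ℕ} (hq : q + 1 < n) :
    (∏ i ∈ range (q + 2), (ent (Raise (q + 2) t) (q + 1) i).weight) *
      (∏ i ∈ range (q + 1), (ent (Raise (q + 2) t) q i).weight) =
    (∏ i ∈ range (q + 2), (ent t (q + 1) i).weight) *
      ∏ i ∈ range (q + 1), (ent t q i).weight := by
  set e := ent t (q + 1) with he
  set v := ent t q with hv
  have hlow : ∀ (f g : TSym n → TSym n → MvPolynomial (Fin n ⊕ Fin n) ℤ),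
      (∀ e j, f e (.num j) = 1) → (∀ e j, g e (.num j) = 1) →
      (∏ i ∈ range (q + 2), (f (e i) (aboveRight t (q + 1) i) *
        g (e i) (aboveLeft t (q + 1) i))) =
      ∏ i ∈ range (q + 1), (f (e i) (v i) * g (e (i + 1)) (v i)) := by
    intro f g hf hg
    rw [prod_mul_distrib, prod_mul_distrib]
    congr 1
    · rw [prod_range_succ, aboveRight, if_neg (lt_irrefl _), hf, mul_one]
      refine prod_congr rfl fun i hi => ?_
      rw [aboveRight, if_pos (mem_range.1 hi)]
      rfl
    · rw [prod_range_succ', aboveLeft, if_neg (by simp), hg, mul_one]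
      refine prod_congr rfl fun i _ => ?_
      rw [aboveLeft, if_pos (by simp)]
      rfl
  have h1 : (∏ i ∈ range (q + 2), (ent (Raise (q + 2) t) (q + 1) i).weight) *
      (∏ i ∈ range (q + 1), (swapRightOld (e i) (v i) * swapLeftOld (e (i + 1)) (v i))) =
      (∏ i ∈ range (q + 2), (e i).weight) *
      (∏ i ∈ range (q + 1), (swapRightNew (e i) (v i) * swapLeftNew (e (i + 1)) (v i))) := by
    rw [← hlow _ _ swapRightOld_num swapLeftOld_num, ← hlow _ _ swapRightNew_num swapLeftNew_num,
      ← prod_mul_distrib, ← prod_mul_distrib]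
    refine prod_congr rfl fun i hi => ?_
    rw [ent_raise_lower t hq (mem_range.1 hi)]
    exact raiseLower_weight _ _ _ _
  have h2 : (∏ i ∈ range (q + 1), (ent (Raise (q + 2) t) q i).weight) *
      (∏ i ∈ range (q + 1), (swapRightNew (e i) (v i) * swapLeftNew (e (i + 1)) (v i))) =
      (∏ i ∈ range (q + 1), (v i).weight) *
      (∏ i ∈ range (q + 1), (swapRightOld (e i) (v i) * swapLeftOld (e (i + 1)) (v i))) := by
    rw [← prod_mul_distrib, ← prod_mul_distrib]
    refine prod_congr rfl fun i hi => ?_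
    rw [ent_raise_upper t hq (mem_range.1 hi)]
    exact raiseUpper_weight _ _ _
  have ho : (∏ i ∈ range (q + 1),
      (swapRightOld (e i) (v i) * swapLeftOld (e (i + 1)) (v i))) ≠ 0 :=
    prod_ne_zero_iff.2 fun i _ =>
      mul_ne_zero (swapRightOld_ne_zero _ _) (swapLeftOld_ne_zero _ _)
  have hn : (∏ i ∈ range (q + 1),
      (swapRightNew (e i) (v i) * swapLeftNew (e (i + 1)) (v i))) ≠ 0 :=
    prod_ne_zero_iff.2 fun i _ =>
      mul_ne_zero (swapRightNew_ne_zero _ _) (swapLeftNew_ne_zero _ _)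
  refine mul_right_cancel₀ (mul_ne_zero ho hn) ?_
  linear_combination h1 * (∏ i ∈ range (q + 1), (ent (Raise (q + 2) t) q i).weight) *
      (∏ i ∈ range (q + 1), (swapRightNew (e i) (v i) * swapLeftNew (e (i + 1)) (v i))) +
    h2 * (∏ i ∈ range (q + 2), (e i).weight) *
      (∏ i ∈ range (q + 1), (swapRightNew (e i) (v i) * swapLeftNew (e (i + 1)) (v i)))

lemma raise_weight (t : Tri n) {m : ℕ} (hm : m + 1 < n) :
    weight (Raise (m + 1) t) = weight t := by
  rw [weight_eq, weight_eq]
  have hmem : m ∈ range (n - 1) := mem_range.2 (by omega)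
  rw [← mul_prod_erase _ _ hmem, ← mul_prod_erase _ _ hmem]
  have hrow : ∀ r, r ≠ m → r + 1 ≠ m →
      ∏ i ∈ range (r + 1), (ent (Raise (m + 1) t) r i).weight =
        ∏ i ∈ range (r + 1), (ent t r i).weight := fun r h1 h2 =>
    prod_congr rfl fun i _ => by rw [ent_raise_of_ne t (by omega) (by omega)]
  obtain _ | q := m
  · congr 1
    · refine prod_congr rfl fun i hi => ?_
      obtain rfl : i = 0 := by simpa using hi
      have h := raiseLower_weight (rankOf t 0) (.num 0) (.num 0) (ent t 0 0)
      rw [swapRightOld_num, swapRightNew_num, swapLeftOld_num, swapLeftNew_num, one_mul, mul_one,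
        mul_one] at h
      rw [ent_raise_lower t (by omega) (by omega), aboveLeft, aboveRight]
      simpa using h
    · exact prod_congr rfl fun r hr => hrow r (mem_erase.1 hr).1 (by omega)
  · have hmem' : q ∈ (range (n - 1)).erase (q + 1) :=
      mem_erase.2 ⟨by omega, mem_range.2 (by omega)⟩
    rw [← mul_prod_erase _ _ hmem', ← mul_prod_erase _ _ hmem', ← mul_assoc, ← mul_assoc,
      raise_weight_rows t (by omega)]
    congr 1
    refine prod_congr rfl fun r hr => hrow r ?_ ?_
    · exact (mem_erase.1 (mem_erase.1 hr).2).1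
    · have := (mem_erase.1 hr).1
      omega

/-- Raising an `𝒳`-row `m` below a `𝒱`-row raises the rank of the row above it by one, and
keeps all other ranks. -/
lemma raise_ranking_mono {t : Tri n} {rk : ℕ → ℕ} {m : ℕ} (hm : m + 1 < n) (hb : BottomOK t)
    (hrk : IsRanking t rk) (hmono : MonoProps t rk) (hX : IsXRow t ⟨m, by omega⟩)
    (hV : ∀ q (hq : q + 1 = m), IsVRow t ⟨q, by omega⟩) :
    IsRanking (Raise (m + 1) t) (Function.update rk m (rk (m + 1) + 1)) ∧
      MonoProps (Raise (m + 1) t) (Function.update rk m (rk (m + 1) + 1)) := by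
  set k := rk (m + 1) with hk
  have hkpos : 0 < k := hrk.pos hb hm
  have hrankOf : rankOf t m = k := rankOf_eq hb hrk hm
  have hXe := (isXRow_iff t (by omega)).1 hX
  have hrkm : rk m = k := by
    rcases hrk.2.2 ⟨m, by omega⟩ (by simp; omega) with ⟨-, h⟩ | ⟨h, -⟩
    · exact h
    · exact absurd ⟨_, h⟩ (IsXRow.not_isVRow hX)
  have hup : ∀ q, q + 1 = m → (∀ i < q + 1, (ent t q i).isV k) ∧ rk q = k + 1 := by
    rintro q rfl
    rcases hrk.2.2 ⟨q, by omega⟩ (by simp; omega) with ⟨h, -⟩ | ⟨h, h'⟩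
    · exact absurd (hV q rfl) (IsXRow.not_isVRow h)
    · simp only [hrkm] at h h'
      exact ⟨(isVRowOf_iff t (by omega) k).1 h, h'⟩
  have hleft : ∀ i < m + 1, (aboveLeft t m i).isV k ∨ ∃ j, aboveLeft t m i = .num j := by
    intro i hi
    unfold aboveLeft
    split_ifs with h
    · exact Or.inl ((hup (m - 1) (by omega)).1 _ (by omega))
    · exact Or.inr ⟨_, rfl⟩
  have hright : ∀ i < m + 1, (aboveRight t m i).isV k ∨ ∃ j, aboveRight t m i = .num j := by
    intro i hi
    unfold aboveRight
    split_ifs with h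
    · exact Or.inl ((hup (m - 1) (by omega)).1 _ (by omega))
    · exact Or.inr ⟨_, rfl⟩
  have hlow : ∀ i < m + 1, (ent (Raise (m + 1) t) m i).isV k ∧
      (ent (Raise (m + 1) t) m i).lval k = (ent t m i).lval k := by
    intro i hi
    rw [ent_raise_lower t (by omega) hi, hrankOf]
    have hbd := ent_bounds hb hmono (show m < n by omega) hi
    exact raiseLower_spec hkpos (hXe i hi) hbd.1 hbd.2 (hleft i hi) (hright i hi)
  constructor
  · refine ⟨?_, fun h => ?_, fun r hr => ?_⟩
    · rw [Function.update_of_ne (by omega)]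
      exact hrk.1
    · rw [Function.update_of_ne (by omega)]
      exact hrk.2.1 h
    · obtain ⟨r, hrn⟩ := r
      simp only at hr ⊢
      rcases eq_or_ne r m with rfl | h1
      · right
        rw [Function.update_of_ne (by omega), Function.update_self, isVRowOf_iff]
        exact ⟨fun i hi => (hlow i hi).1, rfl⟩
      · rcases eq_or_ne (r + 1) m with rfl | h2
        · left
          rw [Function.update_of_ne (by omega), Function.update_self, isXRow_iff]
          refine ⟨fun i hi => ?_, (hup r rfl).2⟩
          rw [ent_raise_upper t (by omega) hi]
          exact raiseUpper_isX ((hup r rfl).1 i hi)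
        · rw [Function.update_of_ne h1, Function.update_of_ne h2]
          simp only [IsXRow, IsVRowOf]
          rw [raise_row_of_ne t ⟨r, hrn⟩ (by simp; omega) (by simp; omega)]
          exact hrk.2.2 ⟨r, hrn⟩ hr
  · rw [monoProps_iff] at hmono ⊢
    intro r p hr hp
    have hM := hmono r p hr hp
    rcases eq_or_ne r m with rfl | h1
    · rw [Function.update_of_ne (by omega), Function.update_of_ne (by omega),
        ent_raise_of_ne t (by omega) (by omega), ent_raise_of_ne t (by omega) (by omega)]
      obtain ⟨hV', hl⟩ := hlow p hp
      simp only [LocalMono, ← hk, hV'.rval_eq, hl, (hXe p hp).rval_eq] at hM ⊢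
      exact hM
    rcases eq_or_ne (r + 1) m with rfl | h2
    · rw [Function.update_of_ne (by omega), Function.update_self, ent_raise_upper t (by omega) hp]
      obtain ⟨hV1, hl1⟩ := hlow p (by omega)
      obtain ⟨hV2, hl2⟩ := hlow (p + 1) (by omega)
      have hv := (hup r rfl).1 p hp
      rw [hrkm, ← hk] at hM
      obtain ⟨ha, hc⟩ :=
        raiseUpper_between (hXe p (by omega)) (hXe (p + 1) (by omega)) hv hM
      refine ⟨?_, fun ⟨j, hj⟩ => absurd hj (hV1.ne_y j), ?_,
        fun ⟨j, hj⟩ => absurd hj (hV2.ne_x j), ?_⟩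
      · rw [← hk, hl1]
        exact ha
      · rw [(raiseUpper_isX hv).rval_eq, hV2.rval_eq, ← hk, hl2]
        push_cast
        omega
      · rw [← hk, hl1, hl2]
        exact hM.2.2.2.2
    rcases eq_or_ne (r + 2) m with rfl | h3
    · have hv1 := (hup (r + 1) rfl).1 p (by omega)
      have hv2 := (hup (r + 1) rfl).1 (p + 1) (by omega)
      have hM1 := hmono (r + 1) p (by omega) (by omega)
      have hM2 := hmono (r + 1) (p + 1) (by omega) (by omega)
      rw [Function.update_self, Function.update_of_ne (by omega),
        ent_raise_of_ne (r := r) t (by omega) (by omega),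
        ent_raise_upper (r := r + 1) t (by omega) (by omega),
        ent_raise_upper (r := r + 1) t (by omega) (by omega)]
      rw [hrkm, ← hk] at hM1 hM2
      have hb1 := raiseUpper_between (hXe p (by omega)) (hXe (p + 1) (by omega)) hv1 hM1
      have hb2 := raiseUpper_between (hXe (p + 1) (by omega)) (hXe (p + 2) (by omega)) hv2 hM2
      rw [hrkm] at hM
      obtain ⟨ha, -, hc, -, -⟩ := hM
      rw [hv2.rval_eq] at hc
      refine ⟨?_, ?_, ?_, ?_, hb1.2.trans_le hb2.1⟩
      · rcases raiseUpper_lval (e := ent t (r + 2) p) (e2 := ent t (r + 2) (p + 1)) hv1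
          with ⟨-, h⟩ | ⟨-, h⟩ <;> rw [h] <;> omega
      · rintro ⟨j, hj⟩
        rcases raiseUpper_lval (e := ent t (r + 2) p) (e2 := ent t (r + 2) (p + 1)) hv1
          with ⟨⟨j', h'⟩, h⟩ | ⟨-, h⟩
        · simp [h'] at hj
        · rw [h]; omega
      · rw [(raiseUpper_isX hv2).rval_eq]
        push_cast
        rcases raiseUpper_lval (e := ent t (r + 2) (p + 1)) (e2 := ent t (r + 2) (p + 2)) hv2
          with ⟨-, h⟩ | ⟨-, h⟩ <;> rw [h] <;> omega
      · rintro ⟨j, hj⟩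
        rw [(raiseUpper_isX hv2).rval_eq]
        push_cast
        rcases raiseUpper_lval (e := ent t (r + 2) (p + 1)) (e2 := ent t (r + 2) (p + 2)) hv2
          with ⟨-, h⟩ | ⟨⟨j', h'⟩, h⟩
        · rw [h]; omega
        · simp [h'] at hj
    · rw [Function.update_of_ne h3, Function.update_of_ne h2,
        ent_raise_of_ne t (by omega) (by omega), ent_raise_of_ne t (by omega) (by omega),
        ent_raise_of_ne t (by omega) (by omega)]
      exact hM

end Entries

/-- Raising preserves admissibility and weight, and raises the rank of row `d-1`
from `t` to `t+1`. -/
theorem stmt13 (n d : ℕ) (t : Tri n) (h1 : 1 ≤ d) (h2 : d < n)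
    (hadm : IsAdmissible t)
    (hX : IsXRow t ⟨d - 1, by omega⟩)
    (hV : ∀ _ : 2 ≤ d, IsVRow t ⟨d - 2, by omega⟩) :
    IsAdmissible (Raise d t) ∧ weight (Raise d t) = weight t ∧
      (2 ≤ d → rankOf (Raise d t) (d - 2) = rankOf t (d - 2) + 1) := by
  have : NeZero n := ⟨by omega⟩
  obtain ⟨m, rfl⟩ : ∃ m, d = m + 1 := ⟨d - 1, by omega⟩
  obtain ⟨hb, -, rk, hrk, hmono⟩ := hadm
  obtain ⟨hrk', hmono'⟩ := raise_ranking_mono h2 hb hrk hmono hX (by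
    rintro q rfl
    exact hV (by omega))
  have hb' : BottomOK (Raise (m + 1) t) := by
    intro r hr
    rw [raise_row_of_ne t r (by omega) (by omega)]
    exact hb r hr
  refine ⟨⟨hb', hrk'.wellFormed, _, hrk', hmono'⟩, raise_weight t h2, fun hd => ?_⟩
  obtain ⟨q, rfl⟩ : ∃ q, m = q + 1 := ⟨m - 1, by omega⟩
  have hq : q + 1 + 1 - 2 = q := by omega
  rw [hq, rankOf_eq hb' hrk' (by omega), Function.update_self,
    rankOf_eq_of_not_isVRow (by omega) (IsXRow.not_isVRow hX), rankOf_eq hb hrk h2]
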